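/- Let K be an algebraically closed field of characteristic p > 0, let F_q ⊆ K be the finite subfield of order q, and let Z = p_1+⋯+p_s be the reduced scheme consisting of all but one of the F_q-rational points of ℙ² (so s = q²+q). Then the least positive integer m such that dim_K [I(mZ)]_{mq} > 0 is m = q, and α̂(I(Z)) = q. -/

import Mathlib

open MvPolynomial

noncomputable section

/-- The ideal of polynomials vanishing on the affine cone over the projective point
with homogeneous coordinate vector `p` (i.e. all forms whose homogeneous components
vanish at `p`, for an infinite field). -/
def coneIdeal (K : Type*) [Field K] {n : ℕ} (p : Fin n → K) :
    Ideal (MvPolynomial (Fin n) K) where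
  carrier := {f | ∀ t : K, eval (t • p) f = 0}
  add_mem' := by
    intro a b ha hb t
    simp only [Set.mem_setOf_eq] at ha hb ⊢
    simp [map_add, ha t, hb t]
  zero_mem' := by
    intro t
    simp
  smul_mem' := by
    intro c f hf t
    simp only [Set.mem_setOf_eq] at hf ⊢
    simp [smul_eq_mul, map_mul, hf t]

/-- The degree-`t` homogeneous component of an ideal, as a `K`-vector subspace. -/
def homComp (K : Type*) [Field K] {n : ℕ} (I : Ideal (MvPolynomial (Fin n) K)) (t : ℕ) :
    Submodule K (MvPolynomial (Fin n) K) :=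
  (Submodule.restrictScalars K I) ⊓ homogeneousSubmodule (Fin n) K t

/-- `α(I)` : the least degree `t` such that `[I]_t ≠ 0`. -/
def alphaDeg (K : Type*) [Field K] {n : ℕ} (I : Ideal (MvPolynomial (Fin n) K)) : ℕ :=
  sInf {t : ℕ | homComp K I t ≠ ⊥}

/-- The ideal of the fat point scheme `Z = m_1 p_1 + ⋯ + m_s p_s`. -/
def fatIdeal (K : Type*) [Field K] {n s : ℕ} (p : Fin s → (Fin n → K)) (m : Fin s → ℕ) :
    Ideal (MvPolynomial (Fin n) K) :=
  ⨅ i, (coneIdeal K (p i)) ^ (m i)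

/-- The `k`-th symbolic power `I(kZ)` of the fat point ideal. -/
def symbPow (K : Type*) [Field K] {n s : ℕ} (p : Fin s → (Fin n → K)) (m : Fin s → ℕ)
    (k : ℕ) : Ideal (MvPolynomial (Fin n) K) :=
  fatIdeal K p (fun i => k * m i)

/-- The Waldschmidt constant `α̂(I(Z)) = inf_{k ≥ 1} α(I(kZ))/k`. -/
def waldschmidt (K : Type*) [Field K] {n s : ℕ} (p : Fin s → (Fin n → K)) (m : Fin s → ℕ) :
    ℝ :=
  ⨅ k : ℕ+, (alphaDeg K (symbPow K p m k) : ℝ) / (k : ℝ)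

/-- The vectors `p i` represent distinct points of projective space. -/
def ProjDistinct (K : Type*) [Field K] {n s : ℕ} (p : Fin s → (Fin n → K)) : Prop :=
  (∀ i, p i ≠ 0) ∧ ∀ i j, i ≠ j → ∀ c : K, p i ≠ c • p j



/-- linear form with coefficient vector `l` -/
def linForm {K : Type*} [Field K] (l : Fin 3 → K) : MvPolynomial (Fin 3) K :=
  ∑ i, C (l i) * X i

/-- Taylor expansion at `p` -/
def phi {K : Type*} [Field K] (p : Fin 3 → K) :
    MvPolynomial (Fin 3) K →ₐ[K] Polynomial (MvPolynomial (Fin 3) K) :=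
  aeval (fun i => Polynomial.C (C (p i)) + Polynomial.X * Polynomial.C (X i))

/-- order of vanishing at least `k` -/
def Van {K : Type*} [Field K] (p : Fin 3 → K) (k : ℕ) (f : MvPolynomial (Fin 3) K) : Prop :=
  ∀ c : K, c ≠ 0 → Polynomial.X ^ k ∣ phi (c • p) f

section
variable {K : Type*} [Field K]

theorem eval_linForm (l x : Fin 3 → K) : eval x (linForm l) = l ⬝ᵥ x := by
  simp [linForm, dotProduct]

theorem linForm_homog (l : Fin 3 → K) : (linForm l).IsHomogeneous 1 := by
  unfold linForm
  exact IsHomogeneous.sum _ _ _ fun i _ => isHomogeneous_C_mul_X _ _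

theorem coeff_linForm (l : Fin 3 → K) (j : Fin 3) :
    (linForm l).coeff (Finsupp.single j 1) = l j := by
  simp [linForm, coeff_sum, coeff_C_mul, coeff_X, Finsupp.single_left_inj]

theorem linForm_ne_zero {l : Fin 3 → K} (hl : l ≠ 0) : linForm l ≠ 0 := by
  intro h
  apply hl
  ext j
  rw [← coeff_linForm l j, h]; simp

theorem linForm_irred {l : Fin 3 → K} (hl : l ≠ 0) : Irreducible (linForm l) := by
  apply irreducible_of_totalDegree_eq_one
  · exact (linForm_homog l).totalDegree (linForm_ne_zero hl)
  · intro x hx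
    obtain ⟨j, hj⟩ : ∃ j, l j ≠ 0 := by
      by_contra! h
      exact hl (funext h)
    have := hx (Finsupp.single j 1)
    rw [coeff_linForm] at this
    exact isUnit_of_dvd_unit this (IsUnit.mk0 _ hj)

theorem phi_coeff_zero (p : Fin 3 → K) (f : MvPolynomial (Fin 3) K) :
    (phi p f).coeff 0 = C (eval p f) := by
  have : (Polynomial.constantCoeff (R := MvPolynomial (Fin 3) K)).comp
      (phi p : MvPolynomial (Fin 3) K →+* _) = (C).comp (eval p) := by
    apply MvPolynomial.ringHom_ext
    · intro r
      simp [phi, IsScalarTower.algebraMap_apply K (MvPolynomial (Fin 3) K) (Polynomial _)]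
    · intro i
      simp [phi]
  exact congrArg (fun g => g f) this

theorem X_dvd_phi (p : Fin 3 → K) (f : MvPolynomial (Fin 3) K) :
    Polynomial.X ∣ phi p f ↔ eval p f = 0 := by
  rw [Polynomial.X_dvd_iff, phi_coeff_zero]
  simp

theorem van_of_mem (p : Fin 3 → K) (k : ℕ) (f : MvPolynomial (Fin 3) K)
    (hf : f ∈ coneIdeal K p ^ k) : Van p k f := by
  intro c _
  have h1 : Ideal.map (phi (c • p)) (coneIdeal K p) ≤ Ideal.span {Polynomial.X} := by
    rw [Ideal.map_le_iff_le_comap]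
    intro g hg
    rw [Ideal.mem_comap, Ideal.mem_span_singleton, X_dvd_phi]
    exact hg c
  have h2 := Ideal.mem_map_of_mem (phi (c • p)) hf
  rw [Ideal.map_pow] at h2
  have h3 := Ideal.pow_right_mono h1 k h2
  rwa [Ideal.span_singleton_pow, Ideal.mem_span_singleton] at h3

theorem phi_linForm (p l : Fin 3 → K) (h : l ⬝ᵥ p = 0) :
    phi p (linForm l) = Polynomial.X * Polynomial.C (linForm l) := by
  have h' : ∑ i, C (l i) * C (p i) = (0 : MvPolynomial (Fin 3) K) := by
    rw [← map_zero C, ← h, dotProduct, map_sum]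
    simp
  have : phi p (linForm l) = Polynomial.C (∑ i, C (l i) * C (p i)) +
      Polynomial.X * Polynomial.C (linForm l) := by
    simp only [linForm, phi, map_sum, map_mul, aeval_X, Finset.mul_sum, ← Finset.sum_add_distrib]
    refine Finset.sum_congr rfl fun i _ => ?_
    have : (aeval (fun i => Polynomial.C (C (p i)) + Polynomial.X * Polynomial.C (X i)))
        (C (l i)) = Polynomial.C (C (l i) : MvPolynomial (Fin 3) K) := by
      simp [IsScalarTower.algebraMap_apply K (MvPolynomial (Fin 3) K) (Polynomial _)]
    rw [this]; ring
  rw [this, h']; simp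

/-- stripping lines, at most one of which passes through `p` -/
theorem van_strip {ι : Type*} [Fintype ι] (l : ι → Fin 3 → K) (hl : ∀ i, l i ≠ 0)
    (p : Fin 3 → K) (hone : ∀ i j, l i ⬝ᵥ p = 0 → l j ⬝ᵥ p = 0 → i = j)
    (k : ℕ) (G : MvPolynomial (Fin 3) K) (h : Van p (k + 1) ((∏ i, linForm (l i)) * G)) :
    Van p k G := by
  classical
  intro c hc
  have hX : Prime (Polynomial.X : Polynomial (MvPolynomial (Fin 3) K)) := Polynomial.prime_X
  have key : ∀ i, Polynomial.X ∣ phi (c • p) (linForm (l i)) → l i ⬝ᵥ p = 0 := by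
    intro i hi
    rw [X_dvd_phi, eval_linForm, dotProduct_smul, smul_eq_mul] at hi
    exact (mul_eq_zero.1 hi).resolve_left hc
  have h0 := h c hc
  rw [map_mul, map_prod] at h0
  by_cases hex : ∃ i, l i ⬝ᵥ p = 0
  · obtain ⟨i, hi⟩ := hex
    rw [← Finset.mul_prod_erase _ _ (Finset.mem_univ i), phi_linForm _ _
      (by rw [dotProduct_smul, hi, smul_zero]), pow_succ', mul_assoc, mul_assoc,
      mul_dvd_mul_iff_left hX.ne_zero, ← mul_assoc] at h0
    refine hX.pow_dvd_of_dvd_mul_left k ?_ h0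
    intro h1
    rcases hX.dvd_or_dvd h1 with h1 | h1
    · rw [Polynomial.X_dvd_iff, Polynomial.coeff_C_zero] at h1
      exact linForm_ne_zero (hl i) h1
    · rw [hX.dvd_finsetProd_iff] at h1
      obtain ⟨j, hj, hj'⟩ := h1
      exact (Finset.mem_erase.1 hj).1 (hone _ _ (key _ hj') hi)
  · refine (pow_dvd_pow _ (Nat.le_succ k)).trans (hX.pow_dvd_of_dvd_mul_left _ ?_ h0)
    intro h1
    rw [hX.dvd_finsetProd_iff] at h1
    obtain ⟨j, -, hj'⟩ := h1
    exact hex ⟨j, key _ hj'⟩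

theorem linForm_dvd [Infinite K] (l : Fin 3 → K) (hl : l ≠ 0) (f : MvPolynomial (Fin 3) K)
    (h : ∀ x, l ⬝ᵥ x = 0 → eval x f = 0) : linForm l ∣ f := by
  obtain ⟨j, hj⟩ : ∃ j, l j ≠ 0 := by
    by_contra! h
    exact hl (funext h)
  let ψ : MvPolynomial (Fin 3) K →ₐ[K] MvPolynomial (Fin 3) K :=
    aeval (fun i => X i - C ((Pi.single j (l j)⁻¹ : Fin 3 → K) i) * linForm l)
  have h1 : ψ f = 0 := by
    apply MvPolynomial.funext
    intro x
    have : eval x (ψ f) = eval (x - (l ⬝ᵥ x) • (Pi.single j (l j)⁻¹ : Fin 3 → K)) f := by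
      simp only [ψ]
      rw [aeval_def, eval_eval₂, ← eval₂_id]
      congr 1
      · ext; simp
      · ext i; simp [eval_linForm, mul_comm]
    rw [this, map_zero]
    apply h
    rw [dotProduct_sub, dotProduct_smul, dotProduct_single, mul_inv_cancel₀ hj]
    simp
  have h2 : (Ideal.Quotient.mkₐ K (Ideal.span {linForm l})).comp ψ =
      Ideal.Quotient.mkₐ K (Ideal.span {linForm l}) := by
    apply MvPolynomial.algHom_ext
    intro i
    have : Ideal.Quotient.mk (Ideal.span {linForm l}) (linForm l) = 0 :=
      Ideal.Quotient.eq_zero_iff_mem.2 (Ideal.mem_span_singleton_self _)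
    simp [ψ, this]
  have h3 := congrArg (fun g => g f) h2
  simp only [AlgHom.comp_apply, h1, map_zero] at h3
  rw [← Ideal.mem_span_singleton]
  exact Ideal.Quotient.eq_zero_iff_mem.1 h3.symm

/-- restriction to an affine line -/
def lineRes (a b : Fin 3 → K) : MvPolynomial (Fin 3) K →ₐ[K] Polynomial K :=
  aeval (fun i => Polynomial.C (a i) + Polynomial.X * Polynomial.C (b i))

theorem eval_lineRes (a b : Fin 3 → K) (t : K) (f : MvPolynomial (Fin 3) K) :
    (lineRes a b f).eval t = eval (a + t • b) f := by
  have : (Polynomial.evalRingHom t).comp (lineRes a b : MvPolynomial (Fin 3) K →+* _) =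
      eval (a + t • b) := by
    apply MvPolynomial.ringHom_ext
    · intro r; simp [lineRes]
    · intro i; simp [lineRes]; ring
  exact congrArg (fun g => g f) this

theorem lineRes_dvd (a b : Fin 3 → K) (u : K) (k : ℕ) (f : MvPolynomial (Fin 3) K)
    (h : Polynomial.X ^ k ∣ phi (a + u • b) f) :
    (Polynomial.X - Polynomial.C u) ^ k ∣ lineRes a b f := by
  let χ : Polynomial (MvPolynomial (Fin 3) K) →+* Polynomial K :=
    Polynomial.eval₂RingHom (Polynomial.C.comp (eval b)) (Polynomial.X - Polynomial.C u)
  have h1 : χ.comp (phi (a + u • b) : MvPolynomial (Fin 3) K →+* _) =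
      (lineRes a b : MvPolynomial (Fin 3) K →+* _) := by
    apply MvPolynomial.ringHom_ext
    · intro r
      simp [χ, phi, lineRes, IsScalarTower.algebraMap_apply K (MvPolynomial (Fin 3) K) (Polynomial (MvPolynomial _ _))]
    · intro i
      simp [χ, phi, lineRes]; ring
  have h2 := congrArg (fun g => g f) h1
  have h3 := map_dvd χ h
  simp only [RingHom.comp_apply, RingHom.coe_coe] at h2
  rw [h2, map_pow] at h3
  simpa [χ] using h3

theorem bezout [Infinite K] (l a b : Fin 3 → K) (hl : l ≠ 0)
    (hker : ∀ x, l ⬝ᵥ x = 0 → ∃ c e : K, x = c • a + e • b)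
    {ι : Type*} [Fintype ι] (u : ι → K) (hu : Function.Injective u)
    (f : MvPolynomial (Fin 3) K) (k : ℕ) (hd : f.totalDegree < k * Fintype.card ι)
    (hv : ∀ i, Van (a + u i • b) k f) : linForm l ∣ f := by
  have hz : ∀ c : K, c ≠ 0 → lineRes (c • a) (c • b) f = 0 := by
    intro c hc
    have hdeg : (lineRes (c • a) (c • b) f).natDegree ≤ f.totalDegree * 1 := by
      apply MvPolynomial.aeval_natDegree_le _ le_rfl
      intro i
      rw [add_comm, mul_comm]
      exact Polynomial.natDegree_linear_le
    have hdvd : (∏ i, (Polynomial.X - Polynomial.C (u i)) ^ k) ∣ lineRes (c • a) (c • b) f := by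
      apply Fintype.prod_dvd_of_coprime
      · intro i j hij
        exact (Polynomial.isCoprime_X_sub_C_of_isUnit_sub
          (IsUnit.mk0 _ (sub_ne_zero.2 (hu.ne hij)))).pow
      · intro i
        apply lineRes_dvd
        have := hv i c hc
        rwa [smul_add, smul_comm c (u i) b] at this
    apply Polynomial.eq_zero_of_dvd_of_natDegree_lt hdvd
    rw [Polynomial.natDegree_prod_of_monic _ _ fun i _ => (Polynomial.monic_X_sub_C _).pow _]
    simp only [Polynomial.natDegree_pow, Polynomial.natDegree_X_sub_C, Finset.sum_const,
      Finset.card_univ, smul_eq_mul]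
    nlinarith
  have hz' : ∀ c e : K, c ≠ 0 → eval (c • a + e • b) f = 0 := by
    intro c e hc
    have := eval_lineRes (c • a) (c • b) (c⁻¹ * e) f
    rw [hz c hc, smul_smul, mul_right_comm, inv_mul_cancel₀ hc, one_mul] at this
    simpa using this.symm
  apply linForm_dvd l hl
  intro x hx
  obtain ⟨c, e, rfl⟩ := hker x hx
  have h0 : lineRes (e • b) a f = 0 := by
    apply Polynomial.eq_zero_of_infinite_isRoot
    refine Set.Infinite.mono ?_ (Set.finite_singleton (0 : K)).infinite_compl
    intro t ht
    simp only [Set.mem_ofPred_eq, Polynomial.IsRoot.def]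
    rw [eval_lineRes, add_comm]
    exact hz' t e ht
  rw [add_comm, ← eval_lineRes, h0]; simp

theorem prod_dvd {ι : Type*} [Fintype ι] (l : ι → Fin 3 → K) (hl : ∀ i, l i ≠ 0)
    (hsep : ∀ i j, i ≠ j → ∃ x, l i ⬝ᵥ x = 0 ∧ l j ⬝ᵥ x ≠ 0)
    (f : MvPolynomial (Fin 3) K) (h : ∀ i, linForm (l i) ∣ f) : (∏ i, linForm (l i)) ∣ f := by
  apply Fintype.prod_dvd_of_isRelPrime
  · intro i j hij
    rw [Function.onFun, (linForm_irred (hl i)).isRelPrime_iff_not_dvd]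
    rintro ⟨g, hg⟩
    obtain ⟨x, hx, hx'⟩ := hsep i j hij
    apply hx'
    rw [← eval_linForm, hg, map_mul, eval_linForm, hx, zero_mul]
  · exact h

theorem prod_homog {ι : Type*} [Fintype ι] (l : ι → Fin 3 → K) :
    (∏ i, linForm (l i)).IsHomogeneous (Fintype.card ι) := by
  have := IsHomogeneous.prod Finset.univ (fun i => linForm (l i)) (fun _ => 1)
    fun i _ => linForm_homog (l i)
  simpa using this

theorem prod_ne {ι : Type*} [Fintype ι] (l : ι → Fin 3 → K) (hl : ∀ i, l i ≠ 0) :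
    (∏ i, linForm (l i)) ≠ 0 :=
  Finset.prod_ne_zero_iff.2 fun i _ => linForm_ne_zero (hl i)

/-- adapted dual basis -/
theorem exists_basis (F : Subfield K) (v₀ : Fin 3 → K) (hv₀ : v₀ ≠ 0) (hF : ∀ a, v₀ a ∈ F) :
    ∃ v1 v2 e0 e1 e2 : Fin 3 → K, (∀ a, v1 a ∈ F) ∧ (∀ a, v2 a ∈ F) ∧
      (∀ a, e0 a ∈ F) ∧ (∀ a, e1 a ∈ F) ∧ (∀ a, e2 a ∈ F) ∧
      e0 ⬝ᵥ v₀ = 1 ∧ e0 ⬝ᵥ v1 = 0 ∧ e0 ⬝ᵥ v2 = 0 ∧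
      e1 ⬝ᵥ v₀ = 0 ∧ e1 ⬝ᵥ v1 = 1 ∧ e1 ⬝ᵥ v2 = 0 ∧
      e2 ⬝ᵥ v₀ = 0 ∧ e2 ⬝ᵥ v1 = 0 ∧ e2 ⬝ᵥ v2 = 1 ∧
      ∀ x, x = (e0 ⬝ᵥ x) • v₀ + (e1 ⬝ᵥ x) • v1 + (e2 ⬝ᵥ x) • v2 := by
  obtain ⟨j, hj⟩ : ∃ j, v₀ j ≠ 0 := by
    by_contra! h
    exact hv₀ (funext h)
  have hs : ∀ (i : Fin 3) (r : K), r ∈ F → ∀ a, (Pi.single i r : Fin 3 → K) a ∈ F := by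
    intro i r hr a
    rw [Pi.single_apply]; split_ifs
    · exact hr
    · exact F.zero_mem
  refine ⟨Pi.single (j+1) 1, Pi.single (j+2) 1, Pi.single j (v₀ j)⁻¹,
    Pi.single (j+1) 1 - Pi.single j (v₀ (j+1) * (v₀ j)⁻¹),
    Pi.single (j+2) 1 - Pi.single j (v₀ (j+2) * (v₀ j)⁻¹), hs _ _ F.one_mem, hs _ _ F.one_mem,
    hs _ _ (F.inv_mem (hF j)), fun a => F.sub_mem (hs _ _ F.one_mem a)
      (hs _ _ (F.mul_mem (hF _) (F.inv_mem (hF j))) a),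
    fun a => F.sub_mem (hs _ _ F.one_mem a)
      (hs _ _ (F.mul_mem (hF _) (F.inv_mem (hF j))) a), ?_⟩
  fin_cases j <;> simp [sub_dotProduct, Pi.single_apply] at * <;>
  · simp [hj]
    intro x
    ext i
    fin_cases i <;> simp [Pi.single_apply] <;> field_simp <;> ring

end

section
variable {K : Type*} [Field K]

theorem van_smul {v : Fin 3 → K} {k : ℕ} {f : MvPolynomial (Fin 3) K} (h : Van v k f)
    (c : K) (hc : c ≠ 0) : Van (c • v) k f := by
  intro d hd
  rw [smul_smul]
  exact h _ (mul_ne_zero hd hc)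

/-- `f` vanishes to order `k` at all `F`-points other than `v₀` -/
def VanAll (F : Subfield K) (v₀ : Fin 3 → K) (k : ℕ) (f : MvPolynomial (Fin 3) K) : Prop :=
  ∀ v : Fin 3 → K, (∀ a, v a ∈ F) → (∀ c : K, v ≠ c • v₀) → Van v k f

theorem lemA [Infinite K] (F : Subfield K) [Fintype F] (v₀ : Fin 3 → K) (hv₀ : v₀ ≠ 0)
    (hF : ∀ a, v₀ a ∈ F) (k : ℕ) : ∀ (f : MvPolynomial (Fin 3) K), VanAll F v₀ k f →
    f.totalDegree < k * Fintype.card F → f = 0 := by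
  obtain ⟨v1, v2, e0, e1, e2, hv1, hv2, he0, he1, he2, h00, h01, h02, h10, h11, h12,
    h20, h21, h22, hx⟩ := exists_basis F v₀ hv₀ hF
  induction k with
  | zero => intro f _ h; simp at h
  | succ k ih =>
    intro f hf hd
    by_contra hne
    let l : F → Fin 3 → K := fun t => e1 + (t : K) • e2
    have hl : ∀ t, l t ≠ 0 := by
      intro t h
      have : l t ⬝ᵥ v1 = 1 := by simp [l, add_dotProduct, smul_dotProduct, h11, h21]
      rw [h] at this; simp at this
    have hdvd : (∏ t, linForm (l t)) ∣ f := by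
      apply prod_dvd l hl
      · intro s t hst
        refine ⟨-(s : K) • v1 + v2, ?_, ?_⟩
        · simp [l, add_dotProduct, smul_dotProduct, dotProduct_add, dotProduct_smul,
            h11, h12, h21, h22]
        · simp only [l, add_dotProduct, smul_dotProduct, dotProduct_add, dotProduct_smul,
            h11, h12, h21, h22]
          simp only [smul_eq_mul]
          intro h
          apply hst
          ext
          linear_combination -h
      · intro t
        refine bezout (l t) (-(t : K) • v1 + v2) v₀ (hl t) ?_ (fun u : F => (u : K))
          Subtype.val_injective f (k + 1) hd ?_
        · intro x h
          refine ⟨e2 ⬝ᵥ x, e0 ⬝ᵥ x, ?_⟩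
          simp only [l, add_dotProduct, smul_dotProduct, smul_eq_mul] at h
          have h' : e1 ⬝ᵥ x = -(t : K) * (e2 ⬝ᵥ x) := by linear_combination h
          conv_lhs => rw [hx x, h']
          module
        · intro u
          apply hf
          · intro a
            exact F.add_mem (F.add_mem (F.mul_mem (F.neg_mem t.2) (hv1 a)) (hv2 a))
              (F.mul_mem u.2 (hF a))
          · intro c h
            have := congrArg (fun v => e2 ⬝ᵥ v) h
            simp [dotProduct_add, dotProduct_smul, h20, h21, h22] at this
    obtain ⟨G, rfl⟩ := hdvd
    have hG : G ≠ 0 := right_ne_zero_of_mul hne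
    apply hG
    apply ih
    · intro v hv hv'
      apply van_strip l hl v _ k G (hf v hv hv')
      intro s t hs ht
      simp only [l, add_dotProduct, smul_dotProduct, smul_eq_mul] at hs ht
      have h1 : ((s : K) - t) * (e2 ⬝ᵥ v) = 0 := by linear_combination hs - ht
      rcases mul_eq_zero.1 h1 with h1 | h1
      · ext; exact sub_eq_zero.1 h1
      · exfalso
        apply hv' (e0 ⬝ᵥ v)
        have h2 : e1 ⬝ᵥ v = 0 := by rw [h1] at hs; simpa using hs
        conv_lhs => rw [hx v, h1, h2]
        simp
    · rw [totalDegree_mul_of_isDomain (prod_ne l hl) hG,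
        (prod_homog l).totalDegree (prod_ne l hl)] at hd
      linarith

theorem lemB [Infinite K] (F : Subfield K) [Fintype F] (v₀ : Fin 3 → K) (hv₀ : v₀ ≠ 0)
    (hF : ∀ a, v₀ a ∈ F) : ∃ P : MvPolynomial (Fin 3) K, P ≠ 0 ∧
      P.IsHomogeneous (Fintype.card F * Fintype.card F) ∧
      (∀ v : Fin 3 → K, (∀ a, v a ∈ F) → (∀ c : K, v ≠ c • v₀) →
        P ∈ coneIdeal K v ^ Fintype.card F) ∧
      ∀ k f, VanAll F v₀ k f → f.totalDegree < k * (Fintype.card F + 1) → P ∣ f := by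
  classical
  obtain ⟨v1, v2, e0, e1, e2, hv1, hv2, he0, he1, he2, h00, h01, h02, h10, h11, h12,
    h20, h21, h22, hx⟩ := exists_basis F v₀ hv₀ hF
  let l : F × F → Fin 3 → K := fun t => e0 + (t.1 : K) • e1 + (t.2 : K) • e2
  have hl : ∀ t, l t ≠ 0 := by
    intro t h
    have : l t ⬝ᵥ v₀ = 1 := by simp [l, add_dotProduct, smul_dotProduct, h00, h10, h20]
    rw [h] at this; simp at this
  have hFd : ∀ e v : Fin 3 → K, (∀ a, e a ∈ F) → (∀ a, v a ∈ F) → e ⬝ᵥ v ∈ F :=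
    fun e v he hv => F.sum_mem fun i _ => F.mul_mem (he i) (hv i)
  refine ⟨∏ t, linForm (l t), prod_ne l hl, ?_, ?_, ?_⟩
  · simpa using prod_homog l
  · intro v hv hv'
    have hlin : ∀ t, l t ⬝ᵥ v = 0 → linForm (l t) ∈ coneIdeal K v := by
      intro t ht c
      rw [eval_linForm, dotProduct_smul, ht, smul_zero]
    obtain ⟨g, hg, hg'⟩ : ∃ g : F → F × F, Function.Injective g ∧ ∀ t, l (g t) ⬝ᵥ v = 0 := by
      simp only [l, add_dotProduct, smul_dotProduct, smul_eq_mul]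
      by_cases h1 : e1 ⬝ᵥ v = 0
      · have h2 : e2 ⬝ᵥ v ≠ 0 := by
          intro h2
          apply hv' (e0 ⬝ᵥ v)
          conv_lhs => rw [hx v, h1, h2]
          simp
        refine ⟨fun s => (s, ⟨-(e0 ⬝ᵥ v + s * (e1 ⬝ᵥ v)) / (e2 ⬝ᵥ v), F.div_mem (F.neg_mem
          (F.add_mem (hFd _ _ he0 hv) (F.mul_mem s.2 (hFd _ _ he1 hv)))) (hFd _ _ he2 hv)⟩),
          fun s t h => congrArg Prod.fst h, ?_⟩
        intro t
        simp only
        field_simp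
        ring
      · refine ⟨fun s => (⟨-(e0 ⬝ᵥ v + s * (e2 ⬝ᵥ v)) / (e1 ⬝ᵥ v), F.div_mem (F.neg_mem
          (F.add_mem (hFd _ _ he0 hv) (F.mul_mem s.2 (hFd _ _ he2 hv)))) (hFd _ _ he1 hv)⟩, s),
          fun s t h => congrArg Prod.snd h, ?_⟩
        intro t
        simp only
        field_simp
        ring
    have h1 : ∏ t : F, linForm (l (g t)) ∈ coneIdeal K v ^ Fintype.card F := by
      have := Ideal.prod_mem_prod (s := (Finset.univ : Finset F)) (I := fun _ => coneIdeal K v)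
        (x := fun t => linForm (l (g t))) fun t _ => hlin _ (hg' t)
      simpa using this
    refine Ideal.mem_of_dvd _ ?_ h1
    rw [← Finset.prod_image (s := Finset.univ) (g := g) (f := fun t => linForm (l t))
      fun _ _ _ _ h => hg h]
    exact Finset.prod_dvd_prod_of_subset _ _ _ (Finset.subset_univ _)
  · intro k f hf hd
    obtain ⟨θ, hθ⟩ : ∃ θ : K, θ ∉ F := by
      by_contra! h
      have : Finite K := Finite.of_injective (fun x : K => (⟨x, h x⟩ : F))
        fun x y h => congrArg Subtype.val h
      exact not_finite K
    have hθ' : ∀ t : F, (t : K) - θ ≠ 0 := by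
      intro t h
      exact hθ (by rw [← sub_eq_zero.1 h]; exact t.2)
    apply prod_dvd l hl
    · intro s t hst
      by_cases h : s.1 = t.1
      · refine ⟨v2 - (s.2 : K) • v₀, ?_, ?_⟩
        · simp only [l, add_dotProduct, smul_dotProduct, dotProduct_sub, dotProduct_smul,
            h02, h12, h22, h00, h10, h20, smul_eq_mul]
          ring
        · simp only [l, add_dotProduct, smul_dotProduct, dotProduct_sub, dotProduct_smul,
            h02, h12, h22, h00, h10, h20, smul_eq_mul]
          intro h'
          apply hst
          ext
          · rw [h]
          · linear_combination -h'
      · refine ⟨v1 - (s.1 : K) • v₀, ?_, ?_⟩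
        · simp only [l, add_dotProduct, smul_dotProduct, dotProduct_sub, dotProduct_smul,
            h01, h11, h21, h00, h10, h20, smul_eq_mul]
          ring
        · simp only [l, add_dotProduct, smul_dotProduct, dotProduct_sub, dotProduct_smul,
            h01, h11, h21, h00, h10, h20, smul_eq_mul]
          intro h'
          apply h
          ext
          linear_combination -h'
    · intro t
      set a : Fin 3 → K := v1 - (t.1 : K) • v₀ with ha
      set b : Fin 3 → K := v2 - (t.2 : K) • v₀ with hb
      have haF : ∀ i, a i ∈ F := fun i => F.sub_mem (hv1 i) (F.mul_mem t.1.2 (hF i))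
      have hbF : ∀ i, b i ∈ F := fun i => F.sub_mem (hv2 i) (F.mul_mem t.2.2 (hF i))
      refine bezout (l t) b (a + θ • b) (hl t) ?_
        (fun u : Option F => u.elim 0 (fun t => ((t : K) - θ)⁻¹)) ?_ f k (by simpa using hd) ?_
      · intro x h
        refine ⟨e2 ⬝ᵥ x - (e1 ⬝ᵥ x) * θ, e1 ⬝ᵥ x, ?_⟩
        simp only [l, add_dotProduct, smul_dotProduct, smul_eq_mul] at h
        have h' : e0 ⬝ᵥ x = -((t.1 : K) * (e1 ⬝ᵥ x) + (t.2 : K) * (e2 ⬝ᵥ x)) := by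
          linear_combination h
        conv_lhs => rw [hx x, h']
        rw [ha, hb]
        module
      · rintro (_ | u) (_ | w) h
        · rfl
        · exact absurd h.symm (inv_ne_zero (hθ' w))
        · exact absurd h (inv_ne_zero (hθ' u))
        · simp only [Option.elim_some, inv_inj, sub_left_inj] at h
          rw [Subtype.ext h]
      · rintro (_ | u)
        · simp only [Option.elim_none, zero_smul, add_zero]
          apply hf _ hbF
          intro c h
          have := congrArg (fun v => e2 ⬝ᵥ v) h
          simp [hb, dotProduct_sub, dotProduct_smul, h20, h22] at this
        · simp only [Option.elim_some]
          have h1 : b + ((u : K) - θ)⁻¹ • (a + θ • b) = ((u : K) - θ)⁻¹ • (a + (u : K) • b) := by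
            have h2 : b = ((u : K) - θ)⁻¹ • (((u : K) - θ) • b) := by
              rw [smul_smul, inv_mul_cancel₀ (hθ' u), one_smul]
            conv_lhs => rw [h2]
            rw [← smul_add]
            congr 1
            rw [← h2]
            module
          rw [h1]
          apply van_smul _ _ (inv_ne_zero (hθ' u))
          apply hf
          · intro i
            exact F.add_mem (haF i) (F.mul_mem u.2 (hbF i))
          · intro c h
            have := congrArg (fun v => e1 ⬝ᵥ v) h
            simp [ha, hb, dotProduct_add, dotProduct_sub, dotProduct_smul, h10, h11, h12] at this

theorem homComp_finite (I : Ideal (MvPolynomial (Fin 3) K)) (t : ℕ) :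
    Module.Finite K (homComp K I t) := by
  have h : Module.Finite K (homogeneousSubmodule (Fin 3) K t) :=
    Module.Finite.iff_fg.2 (homogeneousSubmodule_fg _ _ t)
  exact Submodule.finiteDimensional_of_le (inf_le_right : homComp K I t ≤ _)

theorem mem_symb {s : ℕ} (p : Fin s → Fin 3 → K) (k : ℕ) (f : MvPolynomial (Fin 3) K) :
    f ∈ symbPow K p (fun _ => 1) k ↔ ∀ i, f ∈ coneIdeal K (p i) ^ k := by
  simp [symbPow, fatIdeal, Submodule.mem_iInf]

theorem mem_homComp (I : Ideal (MvPolynomial (Fin 3) K)) (t : ℕ) (f : MvPolynomial (Fin 3) K) :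
    f ∈ homComp K I t ↔ f ∈ I ∧ f.IsHomogeneous t := by
  simp [homComp]

end

set_option maxHeartbeats 1000000 in
/-- Let `K` be algebraically closed of characteristic `c > 0`, `F ⊆ K` a finite subfield
of order `q`, and `Z = p_1 + ⋯ + p_s` the reduced scheme of all but one of the
`F_q`-rational points of `ℙ²` (so `s = q² + q`).  Then the least positive integer `k`
with `dim [I(kZ)]_{kq} > 0` is `k = q`, and `α̂(I(Z)) = q`. -/
theorem finite_field_points (K : Type*) [Field K] [IsAlgClosed K]
    (c : ℕ) (hc : c.Prime) (hchar : CharP K c)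
    (F : Subfield K) (hFfin : Finite F) (q : ℕ) (hq : Nat.card F = q)
    (s : ℕ) (hs : s = q ^ 2 + q)
    (p : Fin s → (Fin 3 → K)) (hp : ProjDistinct K p)
    (hcoords : ∀ i a, p i a ∈ F)
    (v₀ : Fin 3 → K) (hv₀ : v₀ ≠ 0) (hv₀F : ∀ a, v₀ a ∈ F)
    (hv₀not : ∀ i, ∀ c' : K, v₀ ≠ c' • p i)
    (hexh : ∀ v : Fin 3 → K, v ≠ 0 → (∀ a, v a ∈ F) →
      (∃ c' : K, v = c' • v₀) ∨ ∃ i, ∃ c' : K, v = c' • p i) :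
    IsLeast {k : ℕ | 0 < k ∧
      0 < Module.finrank K ↥(homComp K (symbPow K p (fun _ => 1) k) (k * q))} q ∧
    waldschmidt K p (fun _ => 1) = (q : ℝ) := by
  classical
  have : Fintype F := Fintype.ofFinite F
  have : Infinite K := IsAlgClosed.instInfinite
  rw [Nat.card_eq_fintype_card] at hq
  have hq0 : 0 < q := hq ▸ Fintype.card_pos
  obtain ⟨P, hP0, hPh, hPm, hPd⟩ := lemB F v₀ hv₀ hv₀F
  have hA := lemA F v₀ hv₀ hv₀F
  rw [hq] at hPh hPm
  simp only [hq] at hPd hA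
  have hnot : ∀ i, ∀ c : K, p i ≠ c • v₀ := by
    intro i c h
    have hc0 : c ≠ 0 := by
      rintro rfl
      exact hp.1 i (by rw [h, zero_smul])
    apply hv₀not i c⁻¹
    rw [h, smul_smul, inv_mul_cancel₀ hc0, one_smul]
  have hvan : ∀ k f, f ∈ symbPow K p (fun _ => 1) k → VanAll F v₀ k f := by
    intro k f hf v hv hv'
    rw [mem_symb] at hf
    have hv0 : v ≠ 0 := fun h => hv' 0 (by rw [h, zero_smul])
    rcases hexh v hv0 hv with ⟨c', h⟩ | ⟨i, c', h⟩
    · exact absurd h (hv' c')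
    · rw [h]
      refine van_smul (van_of_mem _ _ _ (hf i)) _ ?_
      rintro rfl
      exact hv0 (by rw [h, zero_smul])
  have hPs : ∀ k, P ^ k ∈ symbPow K p (fun _ => 1) (q * k) := by
    intro k
    rw [mem_symb]
    intro i
    rw [pow_mul]
    exact Ideal.pow_mem_pow (hPm _ (hcoords i) (hnot i)) k
  have hPq : P ∈ homComp K (symbPow K p (fun _ => 1) q) (q * q) := by
    rw [mem_homComp]
    refine ⟨?_, hPh⟩
    simpa using hPs 1
  refine ⟨⟨⟨hq0, ?_⟩, ?_⟩, ?_⟩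
  · have := homComp_finite (symbPow K p (fun _ => 1) q) (q * q)
    have : Nontrivial (homComp K (symbPow K p (fun _ => 1) q) (q * q)) :=
      ⟨⟨P, hPq⟩, 0, fun h => hP0 (congrArg Subtype.val h)⟩
    exact Module.finrank_pos
  · rintro k ⟨hk, hfr⟩
    by_contra! hlt
    have := Module.nontrivial_of_finrank_pos hfr
    obtain ⟨⟨f, hf⟩, hne⟩ := exists_ne (0 : homComp K (symbPow K p (fun _ => 1) k) (k * q))
    have hf0 : f ≠ 0 := fun h => hne (Subtype.ext h)
    rw [mem_homComp] at hf
    have hdeg := hf.2.totalDegree hf0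
    obtain ⟨G, rfl⟩ := hPd k f (hvan _ _ hf.1) (by rw [hdeg]; nlinarith)
    rw [totalDegree_mul_of_isDomain hP0 (right_ne_zero_of_mul hf0), hPh.totalDegree hP0] at hdeg
    nlinarith
  · have hlow : ∀ k : ℕ+, (q : ℝ) ≤ (alphaDeg K (symbPow K p (fun _ => 1) k) : ℝ) / (k : ℝ) := by
      intro k
      have hk : (0 : ℝ) < k := by exact_mod_cast k.pos
      rw [le_div_iff₀ hk]
      have hmem : alphaDeg K (symbPow K p (fun _ => 1) k) ∈
          {t : ℕ | homComp K (symbPow K p (fun _ => 1) k) t ≠ ⊥} := by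
        apply Nat.sInf_mem
        refine ⟨q * q * k, ?_⟩
        rw [Set.mem_ofPred_eq, Submodule.ne_bot_iff]
        refine ⟨P ^ (k : ℕ), ?_, pow_ne_zero _ hP0⟩
        rw [mem_homComp]
        refine ⟨?_, hPh.pow k⟩
        have h1 := hPs k
        rw [mem_symb] at h1 ⊢
        intro i
        exact Ideal.pow_le_pow_right (Nat.le_mul_of_pos_left _ hq0) (h1 i)
      rw [Set.mem_ofPred_eq, Submodule.ne_bot_iff] at hmem
      obtain ⟨f, hf, hf0⟩ := hmem
      rw [mem_homComp] at hf
      by_contra! hlt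
      apply hf0
      apply hA k f (hvan _ _ hf.1)
      rw [hf.2.totalDegree hf0, mul_comm]
      exact_mod_cast hlt
    apply le_antisymm
    · have h1 : waldschmidt K p (fun _ => 1) ≤
          (alphaDeg K (symbPow K p (fun _ => 1) (⟨q, hq0⟩ : ℕ+)) : ℝ) / ((⟨q, hq0⟩ : ℕ+) : ℝ) := by
        unfold waldschmidt
        apply ciInf_le
        exact ⟨q, by rintro _ ⟨k, rfl⟩; exact hlow k⟩
      refine h1.trans ?_
      have hq' : (0 : ℝ) < q := by exact_mod_cast hq0
      simp only [PNat.mk_coe]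
      rw [div_le_iff₀ hq']
      have : alphaDeg K (symbPow K p (fun _ => 1) q) ≤ q * q := by
        apply Nat.sInf_le
        rw [Set.mem_ofPred_eq, Submodule.ne_bot_iff]
        exact ⟨P, hPq, hP0⟩
      exact_mod_cast this
    · exact le_ciInf hlow

end
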